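/- If u and v are packed words that both avoid the patterns 132 and 121, then the packed word u∨v avoids the patterns 132 and 121. (This gives a direct proof that the free tridendriform algebra on one generator is stable under the # product.) -/

import Mathlib

/-- The packed word of `u`: if the distinct letters of `u` are `b₁ < b₂ < … < b_r`,
then `pack u` is the image of `u` under the substitution `b_i ↦ i`. -/
def pack (u : List ℕ) : List ℕ :=
  u.map (fun x => (u.toFinset.filter (fun y => y ≤ x)).card)

/-- A word is packed if it is its own packed word. -/
def IsPacked (u : List ℕ) : Prop := pack u = u

/-- The largest letter of a word. -/
def maxL (u : List ℕ) : ℕ := u.foldr max 0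

/-- The packed word `u ∨ v` (lengths `k`, `l`): the first `k` letters are
`u_i + v₁ − 1` if `u_i ≤ u_k` and `u_i + max(v) − 1` if `u_i > u_k`, followed, for
`2 ≤ i ≤ l`, by `v_i` if `v_i < v₁` and `v_i + u_k − 1` if `v_i ≥ v₁`. -/
def veeP (u v : List ℕ) : List ℕ :=
  (u.map (fun x => if x ≤ u.getD (u.length - 1) 0 then x + v.getD 0 0 - 1
      else x + maxL v - 1)) ++
    ((v.drop 1).map (fun y => if y < v.getD 0 0 then y
      else y + u.getD (u.length - 1) 0 - 1))

/-- A word `w` avoids a packed word `p` of length 3 as a pattern if there are no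
positions `i < j < m` (0-indexed here) such that `pack (w_i w_j w_m) = p`. -/
def AvoidsPat (w p : List ℕ) : Prop :=
  ∀ i j m, i < j → j < m → m < w.length →
    pack [w.getD i 0, w.getD j 0, w.getD m 0] ≠ p

theorem pack_triple_eq_132_iff {x y z : ℕ} :
    pack [x, y, z] = [1, 3, 2] ↔ x < z ∧ z < y := by
  rcases lt_trichotomy x y with h1 | h1 | h1 <;> rcases lt_trichotomy y z with h2 | h2 | h2 <;>
    rcases lt_trichotomy x z with h3 | h3 | h3 <;> try omega
  all_goals
    subst_vars
    simp [pack, Finset.filter_insert, Finset.filter_singleton, *, le_of_lt, not_le_of_gt,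
      ne_of_lt, ne_of_gt, not_lt_of_gt]

theorem pack_triple_eq_121_iff {x y z : ℕ} :
    pack [x, y, z] = [1, 2, 1] ↔ x = z ∧ z < y := by
  rcases lt_trichotomy x y with h1 | h1 | h1 <;> rcases lt_trichotomy y z with h2 | h2 | h2 <;>
    rcases lt_trichotomy x z with h3 | h3 | h3 <;> try omega
  all_goals
    subst_vars
    simp [pack, Finset.filter_insert, Finset.filter_singleton, *, le_of_lt, not_le_of_gt,
      ne_of_lt, ne_of_gt, not_lt_of_gt]

theorem avoids_132_121_iff {w : List ℕ} :
    AvoidsPat w [1, 3, 2] ∧ AvoidsPat w [1, 2, 1] ↔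
      ∀ i j m, i < j → j < m → m < w.length →
        ¬ (w.getD i 0 ≤ w.getD m 0 ∧ w.getD m 0 < w.getD j 0) := by
  simp only [AvoidsPat, ne_eq, pack_triple_eq_132_iff, pack_triple_eq_121_iff]
  constructor
  · rintro ⟨h, h'⟩ i j m hij hjm hm
    have := h i j m hij hjm hm
    have := h' i j m hij hjm hm
    omega
  · intro h
    constructor <;> intro i j m hij hjm hm <;> have := h i j m hij hjm hm <;> omega

theorem IsPacked.pos_of_mem {u : List ℕ} (hu : IsPacked u) {x : ℕ} (hx : x ∈ u) : 0 < x := by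
  rw [← hu, pack, List.mem_map] at hx
  obtain ⟨y, hy, rfl⟩ := hx
  exact Finset.card_pos.2 ⟨y, by simp [hy]⟩

theorem IsPacked.getD_pos {u : List ℕ} (hu : IsPacked u) (i : ℕ) (hi : i < u.length) :
    0 < u.getD i 0 := by
  rw [List.getD_eq_getElem _ _ hi]
  exact hu.pos_of_mem (List.getElem_mem hi)

theorem getD_le_maxL (v : List ℕ) (i : ℕ) : v.getD i 0 ≤ maxL v := by
  induction v generalizing i with
  | nil => simp
  | cons a v ih =>
    cases i with
    | zero => simp [maxL]
    | succ i => simpa [maxL] using Or.inr (ih i)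

theorem length_veeP (u v : List ℕ) : (veeP u v).length = u.length + (v.length - 1) := by
  simp [veeP]

theorem getD_veeP_left (u v : List ℕ) {n : ℕ} (hn : n < u.length) :
    (veeP u v).getD n 0 =
      if u.getD n 0 ≤ u.getD (u.length - 1) 0 then u.getD n 0 + v.getD 0 0 - 1
      else u.getD n 0 + maxL v - 1 := by
  rw [veeP, List.getD_append _ _ _ _ (by simpa using hn),
    List.getD_eq_getElem _ _ (by simpa using hn), List.getElem_map,
    List.getD_eq_getElem u 0 hn]

theorem getD_veeP_right (u v : List ℕ) {n : ℕ} (hn : n + 1 < v.length) :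
    (veeP u v).getD (u.length + n) 0 =
      if v.getD (n + 1) 0 < v.getD 0 0 then v.getD (n + 1) 0
      else v.getD (n + 1) 0 + u.getD (u.length - 1) 0 - 1 := by
  rw [veeP, List.getD_append_right _ _ _ _ (by simp), List.length_map, Nat.add_sub_cancel_left,
    List.getD_eq_getElem _ _ (by simp; omega), List.getElem_map, List.getElem_drop,
    List.getD_eq_getElem v 0 hn]
  simp only [Nat.add_comm 1 n]

/-- if `u` and `v` are packed words that both avoid the patterns 132
and 121, then `u ∨ v` avoids the patterns 132 and 121.  (This gives a direct proof
that the free tridendriform algebra on one generator is stable under the #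
product.) -/
theorem veeP_avoids_132_121 (u v : List ℕ)
    (hu : IsPacked u) (hul : 1 ≤ u.length) (hv : IsPacked v) (hvl : 1 ≤ v.length)
    (hu132 : AvoidsPat u [1, 3, 2]) (hu121 : AvoidsPat u [1, 2, 1])
    (hv132 : AvoidsPat v [1, 3, 2]) (hv121 : AvoidsPat v [1, 2, 1]) :
    AvoidsPat (veeP u v) [1, 3, 2] ∧ AvoidsPat (veeP u v) [1, 2, 1] := by
  have hpu := hu.getD_pos
  have hpv := hv.getD_pos
  have hau := avoids_132_121_iff.1 ⟨hu132, hu121⟩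
  have hav := avoids_132_121_iff.1 ⟨hv132, hv121⟩
  rw [avoids_132_121_iff]
  intro i j m hij hjm hm
  rw [length_veeP] at hm
  have ha := hpv 0 hvl
  have hc := hpu (u.length - 1) (by omega)
  have haM := getD_le_maxL v 0
  by_cases him : m < u.length
  · rw [getD_veeP_left u v him, getD_veeP_left u v (hjm.trans him),
      getD_veeP_left u v (n := i) (by omega)]
    have h := hau i j m hij hjm him
    have h1 := hpu i (by omega)
    have h2 := hpu j (by omega)
    have h3 := hpu m (by omega)
    split_ifs <;> omega
  obtain ⟨q, rfl⟩ := Nat.exists_eq_add_of_le (not_lt.1 him)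
  rw [getD_veeP_right u v (n := q) (by omega)]
  have hqM := getD_le_maxL v (q + 1)
  by_cases hju : j < u.length
  · rw [getD_veeP_left u v hju, getD_veeP_left u v (hij.trans hju)]
    have h1 := hpu i (by omega)
    have h2 := hpu j hju
    have h : u.getD j 0 ≤ u.getD (u.length - 1) 0 ∨
        u.getD (u.length - 1) 0 < u.getD i 0 := by
      rcases Nat.lt_or_ge j (u.length - 1) with hj | hj
      · have := hau i j (u.length - 1) hij hj (by omega)
        omega
      · obtain rfl : j = u.length - 1 := by omega
        exact Or.inl le_rfl
    split_ifs <;> omega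
  obtain ⟨r, rfl⟩ := Nat.exists_eq_add_of_le (not_lt.1 hju)
  rw [getD_veeP_right u v (n := r) (by omega)]
  by_cases hiu : i < u.length
  · rw [getD_veeP_left u v hiu]
    have h1 := hpu i hiu
    have h := hav 0 (r + 1) (q + 1) (by omega) (by omega) (by omega)
    split_ifs <;> omega
  obtain ⟨s, rfl⟩ := Nat.exists_eq_add_of_le (not_lt.1 hiu)
  rw [getD_veeP_right u v (n := s) (by omega)]
  have h := hav (s + 1) (r + 1) (q + 1) (by omega) (by omega) (by omega)
  split_ifs <;> omega
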